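/- Let s ≥ 1 and f ∈ C^s[0,1] satisfy f(0), f(1), f'(0), f'(1) ∈ ℤ, f^(i)(0) = f^(i)(1) = 0 for i = 2,…,s, and suppose there is n₀ ≥ s such that for all n ≥ n₀: f(k/n) ≥ f(0) + (k/n)f'(0) for k = 1,…,s, and f(k/n) ≥ f(1) − (1 − k/n)f'(1) for k = n−s,…,n−1. Then there is a constant c = c(s) such that for all n ≥ n₀, sup_{x∈[0,1]} |(B_n f)^(s)(x) − (B̃_n(f))^(s)(x)| ≤ c (ω₁(f^(s), 1/n) + 1/n). -/

import Mathlib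

open Finset

/-- The modulus of continuity of `F` on `[0,1]`. -/
noncomputable def omega1 (F : ℝ → ℝ) (t : ℝ) : ℝ :=
  sSup {d : ℝ | ∃ x ∈ Set.Icc (0:ℝ) 1, ∃ y ∈ Set.Icc (0:ℝ) 1, |x - y| ≤ t ∧ d = |F x - F y|}

open Polynomial in
/-- The polynomial `∑ₖ eₖ bₙₖ` with Bernstein coefficients `eₖ`. -/
noncomputable def bernsteinCombination (n : ℕ) (e : ℕ → ℝ) : ℝ[X] :=
  ∑ k ∈ range (n + 1), C (e k) * bernsteinPolynomial ℝ n k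

theorem eval_bernsteinCombination (n : ℕ) (e : ℕ → ℝ) (x : ℝ) :
    (bernsteinCombination n e).eval x =
      ∑ k ∈ range (n + 1), e k * n.choose k * x ^ k * (1 - x) ^ (n - k) := by
  simp only [bernsteinCombination, bernsteinPolynomial, Polynomial.eval_finsetSum]
  refine sum_congr rfl fun k _ => ?_
  simp
  ring

open Polynomial in
theorem derivative_bernsteinCombination (n : ℕ) (e : ℕ → ℝ) :
    derivative (bernsteinCombination (n + 1) e) =
      C ((n : ℝ) + 1) * bernsteinCombination n fun k => e (k + 1) - e k := by
  have shift : ∑ k ∈ range (n + 1), C (e (k + 1)) * bernsteinPolynomial ℝ n (k + 1) +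
      C (e 0) * bernsteinPolynomial ℝ n 0 =
      ∑ k ∈ range (n + 1), C (e k) * bernsteinPolynomial ℝ n k := by
    rw [← sum_range_succ' (fun k => C (e k) * bernsteinPolynomial ℝ n k), sum_range_succ,
      bernsteinPolynomial.eq_zero_of_lt ℝ n.lt_succ_self, mul_zero, add_zero]
  have step : derivative (bernsteinCombination (n + 1) e) =
      C ((n : ℝ) + 1) * (∑ k ∈ range (n + 1), C (e (k + 1)) * bernsteinPolynomial ℝ n k -
        (∑ k ∈ range (n + 1), C (e (k + 1)) * bernsteinPolynomial ℝ n (k + 1) +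
          C (e 0) * bernsteinPolynomial ℝ n 0)) := by
    rw [bernsteinCombination, derivative_sum, sum_range_succ', mul_sub, mul_add, mul_sum, mul_sum,
      ← sub_sub, ← sum_sub_distrib, sub_eq_add_neg]
    congr 1
    · refine sum_congr rfl fun k _ => ?_
      rw [derivative_C_mul, bernsteinPolynomial.derivative_succ]
      simp
      ring
    · rw [derivative_C_mul, bernsteinPolynomial.derivative_zero]
      simp
      ring
  rw [step, shift, bernsteinCombination, ← sum_sub_distrib]
  congr 1
  refine sum_congr rfl fun k _ => ?_
  rw [C_sub]
  ring

theorem abs_eval_bernsteinCombination_le {n : ℕ} {e : ℕ → ℝ} {M x : ℝ}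
    (he : ∀ k ≤ n, |e k| ≤ M) (hx : x ∈ Set.Icc (0 : ℝ) 1) :
    |(bernsteinCombination n e).eval x| ≤ M := by
  have hx0 : 0 ≤ x := hx.1
  have hx1 : 0 ≤ 1 - x := sub_nonneg.2 hx.2
  rw [eval_bernsteinCombination]
  calc _ ≤ ∑ k ∈ range (n + 1), |e k * n.choose k * x ^ k * (1 - x) ^ (n - k)| :=
        abs_sum_le_sum_abs _ _
    _ ≤ ∑ k ∈ range (n + 1), M * (x ^ k * (1 - x) ^ (n - k) * n.choose k) := by
        refine sum_le_sum fun k hk => ?_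
        have h0 : 0 ≤ x ^ k * (1 - x) ^ (n - k) * n.choose k := by positivity
        rw [show e k * n.choose k * x ^ k * (1 - x) ^ (n - k) =
          e k * (x ^ k * (1 - x) ^ (n - k) * n.choose k) by ring, abs_mul, abs_of_nonneg h0]
        exact mul_le_mul_of_nonneg_right (he k (Nat.lt_succ_iff.1 (mem_range.1 hk))) h0
    _ = M := by rw [← mul_sum, ← add_pow]; simp

open Polynomial in
theorem abs_eval_iterate_derivative_bernsteinCombination_le (s : ℕ) {n : ℕ} {e : ℕ → ℝ}
    {M x : ℝ} (he : ∀ k ≤ n, |e k| ≤ M) (hx : x ∈ Set.Icc (0 : ℝ) 1) :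
    |(derivative^[s] (bernsteinCombination n e)).eval x| ≤ (2 * n) ^ s * M := by
  induction s generalizing n e M with
  | zero => simpa using abs_eval_bernsteinCombination_le he hx
  | succ s ih =>
    have hM : 0 ≤ M := (abs_nonneg _).trans (he 0 n.zero_le)
    rw [Function.iterate_succ_apply]
    cases n with
    | zero => simp [bernsteinCombination, bernsteinPolynomial]
    | succ n =>
      have hd : ∀ k ≤ n, |e (k + 1) - e k| ≤ 2 * M := fun k hk =>
        (abs_sub _ _).trans (by linarith [he (k + 1) (by omega), he k (by omega)])
      rw [derivative_bernsteinCombination, iterate_derivative_C_mul, eval_mul, eval_C, abs_mul,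
        abs_of_nonneg (by positivity)]
      calc _ ≤ ((n : ℝ) + 1) * ((2 * n) ^ s * (2 * M)) := by gcongr; exact ih hd
        _ ≤ ((n : ℝ) + 1) * ((2 * (n + 1)) ^ s * (2 * M)) := by gcongr; linarith
        _ = _ := by push_cast; ring

theorem Polynomial.iteratedDeriv_eval (p : Polynomial ℝ) (s : ℕ) :
    iteratedDeriv s (fun t => p.eval t) = fun t => (Polynomial.derivative^[s] p).eval t := by
  induction s with
  | zero => simp
  | succ s ih =>
    ext t
    rw [iteratedDeriv_succ, ih, Polynomial.deriv, Function.iterate_succ_apply']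

theorem iteratedDeriv_sum_bernstein (n s : ℕ) (e : ℕ → ℝ) (x : ℝ) :
    iteratedDeriv s (fun t => ∑ k ∈ range (n + 1), e k * n.choose k * t ^ k * (1 - t) ^ (n - k)) x =
      (Polynomial.derivative^[s] (bernsteinCombination n e)).eval x := by
  simp_rw [← eval_bernsteinCombination, Polynomial.iteratedDeriv_eval]

theorem bernsteinCombination_sub (n : ℕ) (e e' : ℕ → ℝ) :
    bernsteinCombination n e - bernsteinCombination n e' =
      bernsteinCombination n fun k => e k - e' k := by
  simp only [bernsteinCombination, ← sum_sub_distrib, Polynomial.C_sub, sub_mul]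

theorem abs_sub_le_omega1 {F : ℝ → ℝ} (hF : ContinuousOn F (Set.Icc 0 1)) {t x y : ℝ}
    (hx : x ∈ Set.Icc (0 : ℝ) 1) (hy : y ∈ Set.Icc (0 : ℝ) 1) (hxy : |x - y| ≤ t) :
    |F x - F y| ≤ omega1 F t := by
  obtain ⟨B, hB⟩ := isCompact_Icc.exists_bound_of_continuousOn hF
  refine le_csSup ⟨B + B, ?_⟩ ⟨x, hx, y, hy, hxy, rfl⟩
  rintro d ⟨u, hu, v, hv, -, rfl⟩
  exact (abs_sub _ _).trans (add_le_add (hB u hu) (hB v hv))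

theorem omega1_nonneg (F : ℝ → ℝ) (t : ℝ) : 0 ≤ omega1 F t :=
  Real.sSup_nonneg (by rintro d ⟨u, _, v, _, _, rfl⟩; exact abs_nonneg _)

theorem abs_sub_le_nat_mul_omega1 {F : ℝ → ℝ} (hF : ContinuousOn F (Set.Icc 0 1)) {t x y : ℝ}
    (hx : x ∈ Set.Icc (0 : ℝ) 1) (hy : y ∈ Set.Icc (0 : ℝ) 1) {j : ℕ} (hj : 1 ≤ j)
    (hxy : |x - y| ≤ j * t) : |F x - F y| ≤ j * omega1 F t := by
  have hj0 : (0 : ℝ) < j := by exact_mod_cast hj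
  let p : ℕ → ℝ := fun i => y + (i / j : ℝ) * (x - y)
  have hp : ∀ i ≤ j, p i ∈ Set.Icc (0 : ℝ) 1 := fun i hi =>
    (convex_Icc (0 : ℝ) 1).add_smul_sub_mem hy hx
      ⟨by positivity, div_le_one_of_le₀ (by exact_mod_cast hi) hj0.le⟩
  have hstep : ∀ i < j, |F (p (i + 1)) - F (p i)| ≤ omega1 F t := fun i hi => by
    refine abs_sub_le_omega1 hF (hp _ hi) (hp _ hi.le) ?_
    have : p (i + 1) - p i = (x - y) / j := by simp only [p]; push_cast; field_simp; ring
    rw [this, abs_div, abs_of_pos hj0, div_le_iff₀ hj0]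
    linarith
  have htel : F x - F y = ∑ i ∈ range j, (F (p (i + 1)) - F (p i)) := by
    rw [sum_range_sub fun i => F (p i)]
    simp [p, hj0.ne']
  rw [htel]
  refine (abs_sum_le_sum_abs _ _).trans ?_
  simpa using sum_le_card_nsmul _ _ _ fun i hi => hstep i (mem_range.1 hi)

theorem abs_sub_linear_le {f : ℝ → ℝ} {a c K δ y : ℝ} (ha : a ∈ Set.Icc (0 : ℝ) 1)
    (hf : DifferentiableOn ℝ f (Set.Icc 0 1))
    (hK : ∀ z ∈ Set.Icc (0 : ℝ) 1, |z - a| ≤ δ → |derivWithin f (Set.Icc 0 1) z - c| ≤ K)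
    (hy : y ∈ Set.Icc (0 : ℝ) 1) (hya : |y - a| ≤ δ) :
    |f y - f a - c * (y - a)| ≤ K * δ := by
  have hconv : Convex ℝ (Set.Icc (0 : ℝ) 1 ∩ Metric.closedBall a δ) :=
    (convex_Icc 0 1).inter (convex_closedBall a δ)
  have hδ : 0 ≤ δ := (abs_nonneg _).trans hya
  have key := hconv.norm_image_sub_le_of_norm_hasDerivWithin_le
    (f := fun z => f z - c * z) (f' := fun z => derivWithin f (Set.Icc 0 1) z - c) (C := K)
    (fun z hz => by
      simpa [Pi.sub_def] using ((hf z hz.1).hasDerivWithinAt.mono Set.inter_subset_left).sub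
        ((hasDerivWithinAt_id z _).const_mul c))
    (fun z hz => hK z hz.1 (by simpa [Real.dist_eq] using hz.2))
    ⟨ha, Metric.mem_closedBall_self hδ⟩ ⟨hy, by simpa [Real.dist_eq] using hya⟩
  have hK0 : 0 ≤ K := (abs_nonneg _).trans (hK y hy hya)
  rw [Real.norm_eq_abs, Real.norm_eq_abs] at key
  calc |f y - f a - c * (y - a)| = |f y - c * y - (f a - c * a)| := by ring_nf
    _ ≤ K * |y - a| := key
    _ ≤ K * δ := by gcongr

theorem abs_sub_le_of_iteratedDerivWithin_eq_zero {s : ℕ} {f : ℝ → ℝ} {a M δ : ℝ}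
    (ha : a ∈ Set.Icc (0 : ℝ) 1) (hf : ContDiffOn ℝ s f (Set.Icc 0 1))
    (h0 : ∀ i, 1 ≤ i → i ≤ s → iteratedDerivWithin i f (Set.Icc 0 1) a = 0)
    (hM : ∀ z ∈ Set.Icc (0 : ℝ) 1, |z - a| ≤ δ →
      |iteratedDerivWithin s f (Set.Icc 0 1) z - iteratedDerivWithin s f (Set.Icc 0 1) a| ≤ M)
    {y : ℝ} (hy : y ∈ Set.Icc (0 : ℝ) 1) (hya : |y - a| ≤ δ) : |f y - f a| ≤ M * δ ^ s := by
  induction s generalizing f y with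
  | zero => simpa using hM y hy hya
  | succ s ih =>
    have hu : UniqueDiffOn ℝ (Set.Icc (0 : ℝ) 1) := uniqueDiffOn_Icc zero_lt_one
    have h1 : derivWithin f (Set.Icc 0 1) a = 0 := by simpa using h0 1 le_rfl (by omega)
    have hd : ∀ z ∈ Set.Icc (0 : ℝ) 1, |z - a| ≤ δ →
        |derivWithin f (Set.Icc 0 1) z - derivWithin f (Set.Icc 0 1) a| ≤ M * δ ^ s :=
      fun z hz hza => by
      refine ih (hf.derivWithin hu (by norm_cast)) (fun i hi his => ?_) ?_ hz hza
      · rw [← iteratedDerivWithin_succ']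
        exact h0 (i + 1) (by omega) (by omega)
      · simpa only [← iteratedDerivWithin_succ'] using hM
    have := abs_sub_linear_le ha (hf.differentiableOn (by simp)) hd hy hya
    rw [pow_succ, ← mul_assoc]
    simpa [h1] using this

theorem abs_taylor_remainder_le {s : ℕ} (hs : 1 ≤ s) {f : ℝ → ℝ} {a M δ : ℝ}
    (ha : a ∈ Set.Icc (0 : ℝ) 1) (hf : ContDiffOn ℝ s f (Set.Icc 0 1))
    (h0 : ∀ i, 2 ≤ i → i ≤ s → iteratedDerivWithin i f (Set.Icc 0 1) a = 0)
    (hM : ∀ z ∈ Set.Icc (0 : ℝ) 1, |z - a| ≤ δ →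
      |iteratedDerivWithin s f (Set.Icc 0 1) z - iteratedDerivWithin s f (Set.Icc 0 1) a| ≤ M)
    {y : ℝ} (hy : y ∈ Set.Icc (0 : ℝ) 1) (hya : |y - a| ≤ δ) :
    |f y - f a - derivWithin f (Set.Icc 0 1) a * (y - a)| ≤ M * δ ^ s := by
  obtain ⟨s, rfl⟩ := Nat.exists_eq_add_of_le' hs
  have hu : UniqueDiffOn ℝ (Set.Icc (0 : ℝ) 1) := uniqueDiffOn_Icc zero_lt_one
  rw [pow_succ, ← mul_assoc]
  refine abs_sub_linear_le ha (hf.differentiableOn (by simp)) (fun z hz hza => ?_) hy hya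
  refine abs_sub_le_of_iteratedDerivWithin_eq_zero ha (hf.derivWithin hu (by norm_cast))
    (fun i hi his => ?_) ?_ hz hza
  · rw [← iteratedDerivWithin_succ']
    exact h0 (i + 1) (by omega) (by omega)
  · simpa only [← iteratedDerivWithin_succ'] using hM

theorem Nat.choose_le_choose_of_le_of_le_sub {n m j : ℕ} (hmj : m ≤ j) (hjn : j + m ≤ n) :
    n.choose m ≤ n.choose j := by
  have half : ∀ i, m ≤ i → i ≤ n / 2 → n.choose m ≤ n.choose i := fun i hi => by
    induction i, hi using Nat.le_induction with
    | base => exact fun _ => le_rfl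
    | succ i _ ih => exact fun h =>
        (ih (by omega)).trans (Nat.choose_le_succ_of_lt_half_left (by omega))
  rcases le_or_gt j (n / 2) with h | h
  · exact half j hmj h
  · rw [← Nat.choose_symm (show j ≤ n by omega)]
    exact half (n - j) (by omega) (by omega)

theorem fract_div_le {F D r : ℝ} {m : ℤ} (hD : 0 < D) (hr : 0 ≤ r) (h : F * D = m + r * D) :
    Int.fract (F * D) / D ≤ r := by
  rw [h, Int.fract_intCast_add, div_le_iff₀ hD]
  have : 0 ≤ ⌊r * D⌋ := Int.floor_nonneg.2 (by positivity)
  have : (0 : ℝ) ≤ ⌊r * D⌋ := by exact_mod_cast this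
  rw [Int.fract]
  linarith

theorem exists_nat_eq_div_mul_choose {n k : ℕ} (hn : 1 ≤ n) :
    ∃ m : ℕ, (k : ℝ) / n * n.choose k = m := by
  have hn0 : (n : ℝ) ≠ 0 := by positivity
  obtain ⟨n, rfl⟩ := Nat.exists_eq_add_of_le' hn
  rcases k with _ | k
  · exact ⟨0, by simp⟩
  · refine ⟨n.choose k, ?_⟩
    have := Nat.add_one_mul_choose_eq n k
    rw [div_mul_eq_mul_div, div_eq_iff hn0]
    have : ((n + 1 : ℕ) : ℝ) * n.choose k = (n + 1).choose (k + 1) * (k + 1 : ℕ) := by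
      exact_mod_cast this
    linarith

/-- If `f(k/n)` lies above the tangent line of `f` at an endpoint `a`, and that line has integral
coefficients, then rounding costs at most the distance of `f(k/n)` from the line. -/
theorem fract_div_choose_le {f : ℝ → ℝ} {a d B : ℝ} {n k : ℕ} (hn : 1 ≤ n) (hk : k ≤ n)
    (ha : ∃ m : ℤ, a = m) (hfa : ∃ m : ℤ, f a = m) (hd : ∃ m : ℤ, d = m)
    (hr : 0 ≤ f ((k : ℝ) / n) - f a - d * ((k : ℝ) / n - a))
    (hB : |f ((k : ℝ) / n) - f a - d * ((k : ℝ) / n - a)| ≤ B) :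
    Int.fract (f ((k : ℝ) / n) * n.choose k) / n.choose k ≤ B := by
  obtain ⟨a', ha⟩ := ha
  obtain ⟨b, hb⟩ := hfa
  obtain ⟨d', hd⟩ := hd
  obtain ⟨q, hq⟩ := exists_nat_eq_div_mul_choose (k := k) hn
  refine (fract_div_le (m := b * n.choose k + d' * (q - a' * n.choose k))
    (by exact_mod_cast Nat.choose_pos hk) hr ?_).trans ((le_abs_self _).trans hB)
  push_cast
  rw [← hb, ← hd, ← ha, ← hq]
  ring

theorem inv_choose_le {n s k : ℕ} (hsk : s < k) (hkn : k + s < n) :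
    ((n.choose k : ℝ))⁻¹ ≤ (s + 1).factorial * (s + 1) ^ (s + 1) / (n : ℝ) ^ (s + 1) := by
  have hn : (0 : ℝ) < n := by exact_mod_cast (show 0 < n by omega)
  have h1 : n.choose (s + 1) ≤ n.choose k :=
    Nat.choose_le_choose_of_le_of_le_sub hsk (by omega)
  have h2 : ((n + 1 - (s + 1) : ℕ) ^ (s + 1) : ℝ) / (s + 1).factorial ≤ n.choose (s + 1) :=
    Nat.pow_le_choose (s + 1) n
  have h3 : n ≤ (s + 1) * (n + 1 - (s + 1)) := by
    obtain ⟨m, rfl⟩ := Nat.exists_eq_add_of_le (show s + 1 ≤ n by omega)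
    rw [show s + 1 + m + 1 - (s + 1) = m + 1 by omega]
    nlinarith [Nat.zero_le (s * m)]
  have h4 : (n : ℝ) ^ (s + 1) ≤ (s + 1) ^ (s + 1) * ((n + 1 - (s + 1) : ℕ) : ℝ) ^ (s + 1) := by
    rw [← mul_pow]
    gcongr
    exact_mod_cast h3
  have h5 : (n.choose (s + 1) : ℝ) ≤ n.choose k := by exact_mod_cast h1
  have hf : (0 : ℝ) < (s + 1).factorial := by exact_mod_cast Nat.factorial_pos _
  have hc : (0 : ℝ) < n.choose k := by exact_mod_cast Nat.choose_pos (by omega)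
  rw [inv_le_iff_one_le_mul₀ hc, div_mul_eq_mul_div, one_le_div (by positivity)]
  rw [div_le_iff₀ hf] at h2
  calc _ ≤ _ := h4
    _ ≤ (s + 1) ^ (s + 1) * (n.choose k * (s + 1).factorial) := by
        gcongr
        exact h2.trans (by gcongr)
    _ = _ := by ring

theorem fract_div_choose_endpoint_le {s : ℕ} (hs : 1 ≤ s) {f : ℝ → ℝ} {a : ℝ}
    (ha : a ∈ Set.Icc (0 : ℝ) 1) (ha_int : ∃ m : ℤ, a = m)
    (hf : ContDiffOn ℝ s f (Set.Icc 0 1)) (hfa : ∃ m : ℤ, f a = m)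
    (hd : ∃ m : ℤ, derivWithin f (Set.Icc 0 1) a = m)
    (h0 : ∀ i, 2 ≤ i → i ≤ s → iteratedDerivWithin i f (Set.Icc 0 1) a = 0)
    {n k : ℕ} (hn : 1 ≤ n) (hk : k ≤ n) (hka : |(k : ℝ) / n - a| ≤ s / n)
    (hr : f a + ((k : ℝ) / n - a) * derivWithin f (Set.Icc 0 1) a ≤ f ((k : ℝ) / n)) :
    Int.fract (f ((k : ℝ) / n) * n.choose k) / n.choose k ≤
      s * omega1 (iteratedDerivWithin s f (Set.Icc 0 1)) (1 / n) * (s / n : ℝ) ^ s := by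
  have hcont : ContinuousOn (iteratedDerivWithin s f (Set.Icc 0 1)) (Set.Icc 0 1) :=
    hf.continuousOn_iteratedDerivWithin le_rfl (uniqueDiffOn_Icc zero_lt_one)
  refine fract_div_choose_le hn hk ha_int hfa hd (by linarith) ?_
  refine abs_taylor_remainder_le hs ha hf h0 (fun z hz hza => ?_)
    ⟨by positivity, div_le_one_of_le₀ (by exact_mod_cast hk) (by positivity)⟩ hka
  exact abs_sub_le_nat_mul_omega1 hcont hz ha hs (by rwa [mul_one_div])


/-- Theorem 2.1: simultaneous approximation of `B_n f` by the Kantorovich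
integer Bernstein polynomial `B̃_n(f)`. -/
theorem deriv_bernstein_floor_close (s : ℕ) (hs : 1 ≤ s) :
    ∃ c : ℝ, 0 < c ∧
      ∀ f : ℝ → ℝ,
      ContDiffOn ℝ s f (Set.Icc (0:ℝ) 1) →
      (∃ m : ℤ, f 0 = m) → (∃ m : ℤ, f 1 = m) →
      (∃ m : ℤ, derivWithin f (Set.Icc (0:ℝ) 1) 0 = m) →
      (∃ m : ℤ, derivWithin f (Set.Icc (0:ℝ) 1) 1 = m) →
      (∀ i : ℕ, 2 ≤ i → i ≤ s → iteratedDerivWithin i f (Set.Icc (0:ℝ) 1) 0 = 0) →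
      (∀ i : ℕ, 2 ≤ i → i ≤ s → iteratedDerivWithin i f (Set.Icc (0:ℝ) 1) 1 = 0) →
      ∀ n₀ : ℕ, s ≤ n₀ →
      (∀ n : ℕ, n₀ ≤ n → ∀ k : ℕ, 1 ≤ k → k ≤ s →
        f 0 + ((k : ℝ) / n) * derivWithin f (Set.Icc (0:ℝ) 1) 0 ≤ f ((k : ℝ) / n)) →
      (∀ n : ℕ, n₀ ≤ n → ∀ k : ℕ, n - s ≤ k → k ≤ n - 1 →
        f 1 - (1 - (k : ℝ) / n) * derivWithin f (Set.Icc (0:ℝ) 1) 1 ≤ f ((k : ℝ) / n)) →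
      ∀ n : ℕ, n₀ ≤ n → ∀ x ∈ Set.Icc (0:ℝ) 1,
        |iteratedDeriv s (fun t : ℝ => ∑ k ∈ Finset.range (n + 1),
              f ((k : ℝ) / n) * (n.choose k : ℝ) * t ^ k * (1 - t) ^ (n - k)) x
          - iteratedDeriv s (fun t : ℝ => ∑ k ∈ Finset.range (n + 1),
              (⌊f ((k : ℝ) / n) * (n.choose k : ℝ)⌋ : ℝ) * t ^ k * (1 - t) ^ (n - k)) x|
          ≤ c * (omega1 (iteratedDerivWithin s f (Set.Icc (0:ℝ) 1)) (1 / n) + 1 / n) := by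
  have hs0 : (0 : ℝ) < s := by exact_mod_cast hs
  set A : ℝ := (s : ℝ) ^ (s + 1)
  set B : ℝ := (s + 1).factorial * ((s : ℝ) + 1) ^ (s + 1)
  have hA : 0 < A := by positivity
  have hB : 0 < B := by positivity
  refine ⟨2 ^ s * (A + B), by positivity, ?_⟩
  intro f hf hf0 hf1 hd0 hd1 hz0 hz1 n₀ hn₀ hlow hhigh n hn x hx
  set ω := omega1 (iteratedDerivWithin s f (Set.Icc (0 : ℝ) 1)) (1 / n)
  have hω : 0 ≤ ω := omega1_nonneg _ _
  have hn1 : 1 ≤ n := by omega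
  have hnpos : (0 : ℝ) < n := by exact_mod_cast hn1
  have hendpoint : s * ω * (s / n : ℝ) ^ s ≤ (A + B) * (ω + 1 / n) / n ^ s := by
    rw [div_pow, mul_div_assoc', show (s : ℝ) * ω * s ^ s = A * ω by simp only [A]; ring]
    gcongr
    · linarith
    · simp
  have hcoeff : ∀ k ≤ n, |Int.fract (f ((k : ℝ) / n) * n.choose k) / n.choose k| ≤
      (A + B) * (ω + 1 / n) / n ^ s := fun k hk => by
    rw [abs_of_nonneg (div_nonneg (Int.fract_nonneg _) (Nat.cast_nonneg _))]
    rcases le_or_gt k s with hks | hks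
    · refine (fract_div_choose_endpoint_le hs (a := 0) (by simp) ⟨0, by simp⟩ hf hf0 hd0 hz0
        hn1 hk ?_ ?_).trans hendpoint
      · rw [sub_zero, abs_of_nonneg (by positivity)]
        gcongr
      · rcases Nat.eq_zero_or_pos k with rfl | hkpos
        · simp
        · simpa using hlow n hn k hkpos hks
    rcases le_or_gt n (k + s) with hkn | hkn
    · have hk1 : (k : ℝ) / n ≤ 1 := div_le_one_of_le₀ (by exact_mod_cast hk) hnpos.le
      refine (fract_div_choose_endpoint_le hs (a := 1) (by simp) ⟨1, by simp⟩ hf hf1 hd1 hz1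
        hn1 hk ?_ ?_).trans hendpoint
      · rw [abs_sub_comm, abs_of_nonneg (by linarith), one_sub_div hnpos.ne']
        gcongr
        have : (n : ℝ) ≤ k + s := by exact_mod_cast hkn
        linarith
      · rcases hk.eq_or_lt with rfl | hkn'
        · simp [hnpos.ne']
        · have := hhigh n hn k (by omega) (by omega)
          linarith
    · calc _ ≤ 1 / (n.choose k : ℝ) := by gcongr; exact (Int.fract_lt_one _).le
        _ ≤ B / n ^ (s + 1) := by rw [one_div]; exact inv_choose_le hks hkn
        _ = B * (1 / n) / n ^ s := by rw [pow_succ]; field_simp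
        _ ≤ _ := by
          gcongr
          · linarith
          · linarith
  have hfloor : ∀ t : ℝ, ∑ k ∈ range (n + 1),
      (⌊f ((k : ℝ) / n) * (n.choose k : ℝ)⌋ : ℝ) * t ^ k * (1 - t) ^ (n - k) =
      ∑ k ∈ range (n + 1), (⌊f ((k : ℝ) / n) * (n.choose k : ℝ)⌋ : ℝ) / n.choose k *
        n.choose k * t ^ k * (1 - t) ^ (n - k) := fun t => by
    refine sum_congr rfl fun k hk => ?_
    have hc : (n.choose k : ℝ) ≠ 0 := by
      exact_mod_cast (Nat.choose_pos (Nat.lt_succ_iff.1 (mem_range.1 hk))).ne'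
    rw [div_mul_cancel₀ _ hc]
  simp_rw [hfloor]
  rw [iteratedDeriv_sum_bernstein n s (fun k => f ((k : ℝ) / n)),
    iteratedDeriv_sum_bernstein n s
      (fun k => (⌊f ((k : ℝ) / n) * (n.choose k : ℝ)⌋ : ℝ) / n.choose k),
    ← Polynomial.eval_sub, ← Polynomial.iterate_derivative_sub, bernsteinCombination_sub]
  refine (abs_eval_iterate_derivative_bernsteinCombination_le s
    (M := (A + B) * (ω + 1 / n) / n ^ s) (fun k hk => ?_) hx).trans_eq ?_
  · have hc : (n.choose k : ℝ) ≠ 0 := by exact_mod_cast (Nat.choose_pos hk).ne'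
    convert hcoeff k hk using 2
    rw [Int.fract, sub_div, mul_div_cancel_right₀ _ hc]
  · rw [mul_pow]
    field_simp
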